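/- Assume that either char k = 2 or every |x_i| is even, so that the monomials x_1^{i_1} ... x_n^{i_n} form a k-basis of R. Let I be a DG Poisson ideal of R and A = R/I the induced DG Poisson algebra. If P is a DG symplectic ideal of A, then there exists a simple DG Poisson A-module X such that ann_A(X) = P. -/

import Mathlib

noncomputable section

open scoped DirectSum

/-- The sign `(-1)^m`, as an integer, for `m : ℤ`. -/
def sgn (m : ℤ) : ℤ := (Int.negOnePow m : ℤ)

/-- A differential graded Poisson algebra structure on a `ℤ`-graded `k`-algebra `A`,
whose grading is given by `𝒜`. -/
structure DGPoissonAlgebra (k : Type) [Field k] (A : Type) [Ring A] [Algebra k A]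
    (𝒜 : ℤ → Submodule k A) : Type where
  /-- the Poisson bracket -/
  br : A →ₗ[k] A →ₗ[k] A
  /-- the differential -/
  d : A →ₗ[k] A
  br_mem : ∀ ⦃i j : ℤ⦄ ⦃a b : A⦄, a ∈ 𝒜 i → b ∈ 𝒜 j → br a b ∈ 𝒜 (i + j)
  d_mem : ∀ ⦃i : ℤ⦄ ⦃a : A⦄, a ∈ 𝒜 i → d a ∈ 𝒜 (i + 1)
  antisymm : ∀ ⦃i j : ℤ⦄ ⦃a b : A⦄, a ∈ 𝒜 i → b ∈ 𝒜 j →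
    br a b = -(sgn (i * j) • br b a)
  jacobi : ∀ ⦃i j l : ℤ⦄ ⦃a b c : A⦄, a ∈ 𝒜 i → b ∈ 𝒜 j → c ∈ 𝒜 l →
    br a (br b c) = br (br a b) c + sgn (i * j) • br b (br a c)
  gcomm : ∀ ⦃i j : ℤ⦄ ⦃a b : A⦄, a ∈ 𝒜 i → b ∈ 𝒜 j → a * b = sgn (i * j) • (b * a)
  leibniz : ∀ ⦃i j l : ℤ⦄ ⦃a b c : A⦄, a ∈ 𝒜 i → b ∈ 𝒜 j → c ∈ 𝒜 l →
    br a (b * c) = br a b * c + sgn (i * j) • (b * br a c)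
  d_sq : ∀ a : A, d (d a) = 0
  d_br : ∀ ⦃i j : ℤ⦄ ⦃a b : A⦄, a ∈ 𝒜 i → b ∈ 𝒜 j →
    d (br a b) = br (d a) b + sgn i • br a (d b)
  d_mul : ∀ ⦃i j : ℤ⦄ ⦃a b : A⦄, a ∈ 𝒜 i → b ∈ 𝒜 j →
    d (a * b) = d a * b + sgn i • (a * d b)

/-- A differential graded algebra structure (i.e. a differential) on a `ℤ`-graded
`k`-algebra `B` with grading `ℬ`. -/
structure DGAlgebra (k : Type) [Field k] (B : Type) [Ring B] [Algebra k B]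
    (ℬ : ℤ → Submodule k B) : Type where
  /-- the differential -/
  d : B →ₗ[k] B
  d_mem : ∀ ⦃i : ℤ⦄ ⦃b : B⦄, b ∈ ℬ i → d b ∈ ℬ (i + 1)
  d_sq : ∀ b : B, d (d b) = 0
  d_mul : ∀ ⦃i j : ℤ⦄ ⦃a b : B⦄, a ∈ ℬ i → b ∈ ℬ j →
    d (a * b) = d a * b + sgn i • (a * d b)

/-- `f` is a DG algebra map: a degree-`0` algebra map commuting with the differentials. -/
structure IsDGAlgebraMap (k : Type) [Field k] {A B : Type} [Ring A] [Algebra k A]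
    [Ring B] [Algebra k B] (𝒜 : ℤ → Submodule k A) (ℬ : ℤ → Submodule k B)
    (dA : A →ₗ[k] A) (dB : B →ₗ[k] B) (f : A →ₐ[k] B) : Prop where
  map_mem : ∀ ⦃i : ℤ⦄ ⦃a : A⦄, a ∈ 𝒜 i → f a ∈ ℬ i
  map_d : ∀ a : A, f (dA a) = dB (f a)

/-- The compatibility conditions satisfied by a pair `(f, g)` from a DG Poisson algebra
`A` to a DG algebra `B`: `f` is a DG algebra map, `g` is a degree-`0` `k`-linear map
commuting with the differentials which is a graded Lie algebra map into `B` with the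
graded commutator, and the two mixed identities hold. -/
def UEACompat (k : Type) [Field k] {A B : Type} [Ring A] [Algebra k A]
    [Ring B] [Algebra k B] (𝒜 : ℤ → Submodule k A) (ℬ : ℤ → Submodule k B)
    (P : DGPoissonAlgebra k A 𝒜) (dB : B →ₗ[k] B)
    (f : A →ₐ[k] B) (g : A →ₗ[k] B) : Prop :=
  IsDGAlgebraMap k 𝒜 ℬ P.d dB f ∧
  (∀ ⦃i : ℤ⦄ ⦃a : A⦄, a ∈ 𝒜 i → g a ∈ ℬ i) ∧
  (∀ a : A, g (P.d a) = dB (g a)) ∧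
  (∀ ⦃i j : ℤ⦄ ⦃a b : A⦄, a ∈ 𝒜 i → b ∈ 𝒜 j →
    g (P.br a b) = g a * g b - sgn (i * j) • (g b * g a)) ∧
  (∀ ⦃i j : ℤ⦄ ⦃a b : A⦄, a ∈ 𝒜 i → b ∈ 𝒜 j →
    f (P.br a b) = g a * f b - sgn (i * j) • (f b * g a)) ∧
  (∀ ⦃i j : ℤ⦄ ⦃a b : A⦄, a ∈ 𝒜 i → b ∈ 𝒜 j →
    g (a * b) = f a * g b + sgn (i * j) • (f b * g a))

/-- `(E, α, β)` is a universal enveloping algebra of the DG Poisson algebra `A`. -/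
def IsUEA (k : Type) [Field k] {A E : Type} [Ring A] [Algebra k A] [Ring E] [Algebra k E]
    (𝒜 : ℤ → Submodule k A) (ℰ : ℤ → Submodule k E)
    (P : DGPoissonAlgebra k A 𝒜) (DE : DGAlgebra k E ℰ)
    (α : A →ₐ[k] E) (β : A →ₗ[k] E) : Prop :=
  UEACompat k 𝒜 ℰ P DE.d α β ∧
  ∀ (D : Type) [Ring D] [Algebra k D] (𝒟 : ℤ → Submodule k D) [GradedAlgebra 𝒟]
    (dD : DGAlgebra k D 𝒟) (f : A →ₐ[k] D) (g : A →ₗ[k] D),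
    UEACompat k 𝒜 𝒟 P dD.d f g →
    ∃! φ : E →ₐ[k] D, IsDGAlgebraMap k ℰ 𝒟 DE.d dD.d φ ∧
      φ.comp α = f ∧ φ.toLinearMap.comp β = g

/-- The two-sided ideal of `F` generated by a set `S`, as a `k`-submodule. -/
def idealGen (k : Type) [Field k] {F : Type} [Ring F] [Algebra k F] (S : Set F) :
    Submodule k F :=
  Submodule.span k {z : F | ∃ u v : F, ∃ s ∈ S, z = u * s * v}

/-- The left ideal of `F` generated by a set `S`, as a `k`-submodule. -/
def leftIdealGen (k : Type) [Field k] {F : Type} [Ring F] [Algebra k F] (S : Set F) :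
    Submodule k F :=
  Submodule.span k {z : F | ∃ u : F, ∃ s ∈ S, z = u * s}

/-- A submodule is graded if it is spanned by its homogeneous elements. -/
def IsGradedSubmodule (k : Type) [Field k] {A : Type} [AddCommGroup A] [Module k A]
    (𝒜 : ℤ → Submodule k A) (M : Submodule k A) : Prop :=
  M ≤ Submodule.span k {a : A | a ∈ M ∧ ∃ i, a ∈ 𝒜 i}

/-- A `k`-submodule which is a two-sided ideal. -/
def IsTwoSidedIdealSub (k : Type) [Field k] {A : Type} [Ring A] [Algebra k A]
    (M : Submodule k A) : Prop :=
  ∀ r : A, ∀ m ∈ M, r * m ∈ M ∧ m * r ∈ M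

/-- A DG ideal: a graded two-sided ideal closed under the differential `d`. -/
def IsDGIdeal (k : Type) [Field k] {A : Type} [Ring A] [Algebra k A]
    (𝒜 : ℤ → Submodule k A) (d : A →ₗ[k] A) (M : Submodule k A) : Prop :=
  IsTwoSidedIdealSub k M ∧ IsGradedSubmodule k 𝒜 M ∧ ∀ m ∈ M, d m ∈ M

/-- A DG Poisson ideal: a DG ideal which is also closed under the Poisson bracket. -/
def IsDGPoissonIdeal (k : Type) [Field k] {A : Type} [Ring A] [Algebra k A]
    (𝒜 : ℤ → Submodule k A) (P : DGPoissonAlgebra k A 𝒜) (M : Submodule k A) : Prop :=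
  IsDGIdeal k 𝒜 P.d M ∧ ∀ a : A, ∀ m ∈ M, P.br a m ∈ M

/-- `π : A → B` presents `B` as the quotient of `A` by `I`. -/
structure IsQuotientBy (k : Type) [Field k] {A B : Type} [Ring A] [Algebra k A]
    [Ring B] [Algebra k B] (π : A →ₐ[k] B) (I : Submodule k A) : Prop where
  surj : Function.Surjective π
  ker : ∀ a : A, π a = 0 ↔ a ∈ I

/-- The (noncommutative, ordered) monomial `x 0 ^ e 0 * x 1 ^ e 1 * ⋯` . -/
def xMono {n : ℕ} {R : Type} [Ring R] (x : Fin n → R) (e : Fin n → ℕ) : R :=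
  ((List.finRange n).map fun r => x r ^ e r).prod

section Signs

theorem sgn_add (m n : ℤ) : sgn (m + n) = sgn m * sgn n := by
  simp [sgn, Int.negOnePow_add]

theorem sgn_eq_one_or (m : ℤ) : sgn m = 1 ∨ sgn m = -1 := by
  rcases Int.units_eq_one_or (Int.negOnePow m) with h | h <;> simp [sgn, h]

end Signs

section Graded

variable {k A : Type} [Field k] [Ring A] [Algebra k A] (ℬ : ℤ → Submodule k A) [GradedAlgebra ℬ]

/-- Linear maps out of a graded algebra agree as soon as they agree on homogeneous elements. -/
theorem linearMap_ext_of_homogeneous {N : Type} [AddCommGroup N] [Module k N] {f g : A →ₗ[k] N}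
    (h : ∀ i, ∀ a ∈ ℬ i, f a = g a) : f = g :=
  DirectSum.decompose_lhom_ext ℬ fun i => LinearMap.ext fun a => h i a a.2

theorem proj_of_mem {i : ℤ} {a : A} (ha : a ∈ ℬ i) (j : ℤ) :
    GradedAlgebra.proj ℬ j a = if i = j then a else 0 := by
  split_ifs with h
  · subst h
    exact DirectSum.decompose_of_mem_same ℬ ha
  · exact DirectSum.decompose_of_mem_ne ℬ ha h

theorem proj_mem (i : ℤ) (a : A) : GradedAlgebra.proj ℬ i a ∈ ℬ i :=
  SetLike.coe_mem _

/-- The linear map multiplying a homogeneous element of degree `i` by `(-1)^i`. -/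
def signMap : A →ₗ[k] A :=
  DirectSum.toModule k ℤ A (fun i => sgn i • (ℬ i).subtype) ∘ₗ
    (DirectSum.decomposeLinearEquiv ℬ).toLinearMap

theorem signMap_of_mem {i : ℤ} {a : A} (ha : a ∈ ℬ i) : signMap ℬ a = sgn i • a := by
  have := DirectSum.decomposeLinearEquiv_apply_coe (R := k) ℬ i ⟨a, ha⟩
  simp only at this
  simp [signMap, this]

variable {ℬ}

theorem isGradedSubmodule_iff {K : Submodule k A} :
    IsGradedSubmodule k ℬ K ↔ ∀ i, ∀ a ∈ K, GradedAlgebra.proj ℬ i a ∈ K := by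
  constructor
  · intro h i a ha
    have hle : Submodule.span k {a : A | a ∈ K ∧ ∃ i, a ∈ ℬ i} ≤
        K.comap (GradedAlgebra.proj ℬ i) := by
      rw [Submodule.span_le]
      rintro b ⟨hb, j, hj⟩
      rw [SetLike.mem_coe, Submodule.mem_comap, proj_of_mem ℬ hj]
      split_ifs
      exacts [hb, K.zero_mem]
    exact hle (h ha)
  · intro h a ha
    classical
    rw [← DirectSum.sum_support_decompose ℬ a]
    exact Submodule.sum_mem _ fun i _ => Submodule.subset_span ⟨h i a ha, i, SetLike.coe_mem _⟩

omit [GradedAlgebra ℬ] in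
/-- To show that a graded submodule maps into another submodule, homogeneous elements suffice. -/
theorem IsGradedSubmodule.induction {K : Submodule k A} (hK : IsGradedSubmodule k ℬ K)
    {N : Type} [AddCommGroup N] [Module k N] (f : A →ₗ[k] N) (L : Submodule k N)
    (h : ∀ i, ∀ a ∈ ℬ i, a ∈ K → f a ∈ L) : ∀ a ∈ K, f a ∈ L := by
  intro a ha
  have hle : Submodule.span k {a : A | a ∈ K ∧ ∃ i, a ∈ ℬ i} ≤ L.comap f :=
    Submodule.span_le.2 fun b ⟨hb, i, hi⟩ => h i b hi hb
  exact hle (hK ha)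

theorem forall_mem_of_homogeneous {N : Type} [AddCommGroup N] [Module k N] (f : A →ₗ[k] N)
    (L : Submodule k N) (h : ∀ i, ∀ a ∈ ℬ i, f a ∈ L) (a : A) : f a ∈ L :=
  IsGradedSubmodule.induction (ℬ := ℬ) (K := ⊤)
    (isGradedSubmodule_iff.2 fun _ _ _ => Submodule.mem_top) f L
    (fun i a ha _ => h i a ha) a Submodule.mem_top

end Graded

/-- The Leibniz rule in the first argument of the bracket. -/
theorem DGPoissonAlgebra.br_mul_left {k A : Type} [Field k] [Ring A] [Algebra k A]
    {ℬ : ℤ → Submodule k A} [GradedAlgebra ℬ] (PA : DGPoissonAlgebra k A ℬ) {i j l : ℤ}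
    {a b c : A} (ha : a ∈ ℬ i) (hb : b ∈ ℬ j) (hc : c ∈ ℬ l) :
    PA.br (a * b) c = a * PA.br b c + sgn (j * l) • (PA.br a c * b) := by
  rw [PA.antisymm (SetLike.mul_mem_graded ha hb) hc, PA.leibniz hc ha hb, PA.antisymm ha hc,
    PA.antisymm hb hc, add_mul, sgn_add, mul_comm l i, mul_comm j l]
  rcases sgn_eq_one_or (i * l) with hi | hi <;> rcases sgn_eq_one_or (l * j) with hl | hl <;>
    simp [hi, hl]

/-- A representation of the DG Poisson algebra `A` in an associative algebra `E`: elements of `A`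
act through `α`, their brackets through `β`, the differential through `δ`, and the `p i` are the
projections to the graded pieces. -/
structure PoissonRep {k A : Type} [Field k] [Ring A] [Algebra k A] (ℬ : ℤ → Submodule k A)
    (PA : DGPoissonAlgebra k A ℬ) (E : Type) [Ring E] [Algebra k E] where
  /-- the action by multiplication -/
  α : A →ₗ[k] E
  /-- the action by brackets -/
  β : A →ₗ[k] E
  /-- the differential -/
  δ : E
  /-- the projections to the graded pieces -/
  p : ℤ → E
  α_one : α 1 = 1
  α_mul : ∀ a b, α (a * b) = α a * α b
  p_mul : ∀ i j, p i * p j = if i = j then p i else 0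
  α_p : ∀ ⦃i : ℤ⦄ ⦃a : A⦄, a ∈ ℬ i → ∀ j, α a * p j = p (i + j) * α a
  β_p : ∀ ⦃i : ℤ⦄ ⦃a : A⦄, a ∈ ℬ i → ∀ j, β a * p j = p (i + j) * β a
  δ_p : ∀ j, δ * p j = p (j + 1) * δ
  δ_sq : δ * δ = 0
  δ_α : ∀ ⦃i : ℤ⦄ ⦃a : A⦄, a ∈ ℬ i → δ * α a = α (PA.d a) + sgn i • (α a * δ)
  δ_β : ∀ ⦃i : ℤ⦄ ⦃a : A⦄, a ∈ ℬ i → δ * β a = β (PA.d a) + sgn i • (β a * δ)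
  β_α : ∀ ⦃i j : ℤ⦄ ⦃a b : A⦄, a ∈ ℬ i → b ∈ ℬ j →
    β a * α b = α (PA.br a b) + sgn (i * j) • (α b * β a)
  β_mul : ∀ ⦃i j : ℤ⦄ ⦃a b : A⦄, a ∈ ℬ i → b ∈ ℬ j →
    β (a * b) = α a * β b + sgn (i * j) • (α b * β a)
  β_β : ∀ ⦃i j : ℤ⦄ ⦃a b : A⦄, a ∈ ℬ i → b ∈ ℬ j →
    β a * β b = β (PA.br a b) + sgn (i * j) • (β b * β a)

namespace PoissonRep

variable {k A : Type} [Field k] [Ring A] [Algebra k A] {ℬ : ℤ → Submodule k A}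
  {PA : DGPoissonAlgebra k A ℬ} {E : Type} [Ring E] [Algebra k E]

/-- The elements of `E` through which the structure acts. -/
def gens (ρ : PoissonRep ℬ PA E) : Set E :=
  Set.range ρ.α ∪ Set.range ρ.β ∪ {ρ.δ} ∪ Set.range ρ.p

/-- Restriction of a representation to the subalgebra generated by its image. -/
def restrict (ρ : PoissonRep ℬ PA E) : PoissonRep ℬ PA (Algebra.adjoin k ρ.gens) where
  α := ρ.α.codRestrict (Subalgebra.toSubmodule (Algebra.adjoin k ρ.gens)) fun a =>
    Algebra.subset_adjoin (by simp [gens])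
  β := ρ.β.codRestrict (Subalgebra.toSubmodule (Algebra.adjoin k ρ.gens)) fun a =>
    Algebra.subset_adjoin (by simp [gens])
  δ := ⟨ρ.δ, Algebra.subset_adjoin (by simp [gens])⟩
  p i := ⟨ρ.p i, Algebra.subset_adjoin (by simp [gens])⟩
  α_one := Subtype.ext ρ.α_one
  α_mul a b := Subtype.ext (ρ.α_mul a b)
  p_mul i j := Subtype.ext (by
    have := ρ.p_mul i j
    split_ifs at this ⊢ <;> exact this)
  α_p _ _ ha j := Subtype.ext (ρ.α_p ha j)
  β_p _ _ ha j := Subtype.ext (ρ.β_p ha j)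
  δ_p j := Subtype.ext (ρ.δ_p j)
  δ_sq := Subtype.ext ρ.δ_sq
  δ_α _ _ ha := Subtype.ext (ρ.δ_α ha)
  δ_β _ _ ha := Subtype.ext (ρ.δ_β ha)
  β_α _ _ _ _ ha hb := Subtype.ext (ρ.β_α ha hb)
  β_mul _ _ _ _ ha hb := Subtype.ext (ρ.β_mul ha hb)
  β_β _ _ _ _ ha hb := Subtype.ext (ρ.β_β ha hb)

theorem adjoin_gens_restrict (ρ : PoissonRep ℬ PA E) :
    Algebra.adjoin k ρ.restrict.gens = ⊤ := by
  rw [eq_top_iff, ← Algebra.adjoin_adjoin_coe_preimage]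
  refine Algebra.adjoin_mono ?_
  rintro ⟨e, he⟩ (((⟨a, rfl⟩ | ⟨a, rfl⟩) | h) | ⟨i, rfl⟩)
  · exact Or.inl (Or.inl (Or.inl ⟨a, rfl⟩))
  · exact Or.inl (Or.inl (Or.inr ⟨a, rfl⟩))
  · exact Or.inl (Or.inr (Subtype.ext h))
  · exact Or.inr ⟨i, rfl⟩

/-- The right regular representation of a DG Poisson algebra on itself. -/
def regular [GradedAlgebra ℬ] (PA : DGPoissonAlgebra k A ℬ) :
    PoissonRep ℬ PA (Module.End k A)ᵐᵒᵖ where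
  α := (MulOpposite.opLinearEquiv k).toLinearMap ∘ₗ (LinearMap.mul k A).flip
  β := (MulOpposite.opLinearEquiv k).toLinearMap ∘ₗ PA.br.flip
  δ := MulOpposite.op (-(PA.d ∘ₗ signMap ℬ))
  p i := MulOpposite.op (GradedAlgebra.proj ℬ (-i))
  α_one := MulOpposite.unop_injective <| LinearMap.ext fun c => mul_one c
  α_mul a b := MulOpposite.unop_injective <| LinearMap.ext fun c => (mul_assoc c a b).symm
  p_mul i j := MulOpposite.unop_injective <| linearMap_ext_of_homogeneous ℬ fun l c hc => by
    change GradedAlgebra.proj ℬ (-j) (GradedAlgebra.proj ℬ (-i) c) = _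
    simp only [proj_of_mem ℬ (proj_mem ℬ (-i) c), neg_inj]
    split_ifs <;> rfl
  α_p i a ha j := MulOpposite.unop_injective <| linearMap_ext_of_homogeneous ℬ fun l c hc => by
    change GradedAlgebra.proj ℬ (-j) (c * a) = GradedAlgebra.proj ℬ (-(i + j)) c * a
    have : l + i = -j ↔ l = -(i + j) := by omega
    have hca : c * a ∈ ℬ (l + i) := SetLike.mul_mem_graded hc ha
    simp only [proj_of_mem ℬ hc, proj_of_mem ℬ hca, this, ite_mul, zero_mul]
  β_p i a ha j := MulOpposite.unop_injective <| linearMap_ext_of_homogeneous ℬ fun l c hc => by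
    change GradedAlgebra.proj ℬ (-j) (PA.br c a) = PA.br (GradedAlgebra.proj ℬ (-(i + j)) c) a
    have : l + i = -j ↔ l = -(i + j) := by omega
    simp only [proj_of_mem ℬ hc, proj_of_mem ℬ (PA.br_mem hc ha), this]
    split_ifs <;> simp
  δ_p j := MulOpposite.unop_injective <| linearMap_ext_of_homogeneous ℬ fun l c hc => by
    change GradedAlgebra.proj ℬ (-j) (-PA.d (signMap ℬ c)) =
      -PA.d (signMap ℬ (GradedAlgebra.proj ℬ (-(j + 1)) c))
    have : l + 1 = -j ↔ l = -(j + 1) := by omega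
    rw [signMap_of_mem ℬ hc, signMap_of_mem ℬ (proj_mem ℬ _ c), proj_of_mem ℬ hc, map_zsmul,
      map_neg, map_zsmul, proj_of_mem ℬ (PA.d_mem hc)]
    simp only [this]
    split_ifs with h
    · rw [h, map_zsmul]
    · simp
  δ_sq := MulOpposite.unop_injective <| linearMap_ext_of_homogeneous ℬ fun l c hc => by
    change -PA.d (signMap ℬ (-PA.d (signMap ℬ c))) = 0
    rw [signMap_of_mem ℬ hc, map_zsmul, map_neg, map_zsmul, signMap_of_mem ℬ (PA.d_mem hc),
      map_neg, map_zsmul, map_zsmul, PA.d_sq, smul_zero, smul_zero, neg_zero, neg_zero]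
  δ_α i a ha := MulOpposite.unop_injective <| linearMap_ext_of_homogeneous ℬ fun l c hc => by
    change -PA.d (signMap ℬ c) * a = c * PA.d a + sgn i • (-PA.d (signMap ℬ (c * a)))
    rw [signMap_of_mem ℬ hc, signMap_of_mem ℬ (SetLike.mul_mem_graded hc ha), map_zsmul,
      map_zsmul, PA.d_mul hc ha, sgn_add]
    rcases sgn_eq_one_or i with hi | hi <;> rcases sgn_eq_one_or l with hl | hl <;>
      simp [hi, hl]
  δ_β i a ha := MulOpposite.unop_injective <| linearMap_ext_of_homogeneous ℬ fun l c hc => by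
    change PA.br (-PA.d (signMap ℬ c)) a =
      PA.br c (PA.d a) + sgn i • (-PA.d (signMap ℬ (PA.br c a)))
    rw [signMap_of_mem ℬ hc, signMap_of_mem ℬ (PA.br_mem hc ha), map_zsmul,
      map_zsmul, PA.d_br hc ha, sgn_add]
    rcases sgn_eq_one_or i with hi | hi <;> rcases sgn_eq_one_or l with hl | hl <;>
      simp [hi, hl]
  β_α i j a b ha hb := MulOpposite.unop_injective <| linearMap_ext_of_homogeneous ℬ
    fun l c hc => by
    change PA.br c a * b = c * PA.br a b + sgn (i * j) • PA.br (c * b) a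
    rw [PA.br_mul_left hc hb ha, PA.antisymm hb ha, mul_comm j i]
    rcases sgn_eq_one_or (i * j) with hi | hi <;> simp [hi]
  β_mul i j a b ha hb := MulOpposite.unop_injective <| linearMap_ext_of_homogeneous ℬ
    fun l c hc => by
    change PA.br c (a * b) = PA.br (c * a) b + sgn (i * j) • PA.br (c * b) a
    rw [PA.br_mul_left hc ha hb, PA.br_mul_left hc hb ha, PA.leibniz hc ha hb,
      PA.antisymm hb ha, PA.gcomm ha (PA.br_mem hc hb), mul_comm j i, mul_add, sgn_add,
      mul_comm l i]
    rcases sgn_eq_one_or (i * j) with hi | hi <;> rcases sgn_eq_one_or (i * l) with hl | hl <;>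
      simp [hi, hl] <;> abel
  β_β i j a b ha hb := MulOpposite.unop_injective <| linearMap_ext_of_homogeneous ℬ
    fun l c hc => by
    change PA.br (PA.br c a) b = PA.br c (PA.br a b) + sgn (i * j) • PA.br (PA.br c b) a
    rw [PA.jacobi hc ha hb, PA.antisymm ha (PA.br_mem hc hb), mul_add, sgn_add, mul_comm l i]
    rcases sgn_eq_one_or (i * j) with hi | hi <;> rcases sgn_eq_one_or (i * l) with hl | hl <;>
      simp [hi, hl]

section Action

variable {X : Type} [AddCommGroup X] [Module k X] [Module E X] [IsScalarTower k E X]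

/-- The degree `i` piece of an `E`-module. -/
def piece (ρ : PoissonRep ℬ PA E) (X : Type) [AddCommGroup X] [Module k X] [Module E X]
    [IsScalarTower k E X] (i : ℤ) : Submodule k X :=
  LinearMap.range (Algebra.lsmul k k X (ρ.p i))

theorem mem_piece {ρ : PoissonRep ℬ PA E} {i : ℤ} {x : X} :
    x ∈ ρ.piece X i ↔ ρ.p i • x = x := by
  constructor
  · rintro ⟨y, rfl⟩
    simp [smul_smul, ρ.p_mul]
  · intro h
    exact ⟨x, h⟩

theorem p_smul_of_mem {ρ : PoissonRep ℬ PA E} {i : ℤ} {x : X} (hx : x ∈ ρ.piece X i) (j : ℤ) :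
    ρ.p j • x = if i = j then x else 0 := by
  rw [← mem_piece.1 hx, smul_smul, ρ.p_mul]
  by_cases h : i = j
  · simp [h]
  · simp [h, Ne.symm h]

theorem smul_mem_piece {ρ : PoissonRep ℬ PA E} {e : E} {i j : ℤ}
    (he : e * ρ.p j = ρ.p i * e) {x : X} (hx : x ∈ ρ.piece X j) : e • x ∈ ρ.piece X i := by
  rw [mem_piece, smul_smul, ← he, ← smul_smul, mem_piece.1 hx]

/-- A submodule stable under the generators of `E` is stable under `E`; in a simple module it is
therefore trivial. -/
theorem eq_bot_or_eq_top [IsSimpleModule E X] (ρ : PoissonRep ℬ PA E)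
    (hgen : Algebra.adjoin k ρ.gens = ⊤) (N : Submodule k X)
    (hα : ∀ a, ∀ x ∈ N, ρ.α a • x ∈ N) (hβ : ∀ a, ∀ x ∈ N, ρ.β a • x ∈ N)
    (hδ : ∀ x ∈ N, ρ.δ • x ∈ N) (hp : ∀ i, ∀ x ∈ N, ρ.p i • x ∈ N) : N = ⊥ ∨ N = ⊤ := by
  have hE : ∀ e : E, ∀ x ∈ N, e • x ∈ N := by
    intro e
    have he : e ∈ Algebra.adjoin k ρ.gens := hgen ▸ Algebra.mem_top
    induction he using Algebra.adjoin_induction with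
    | mem e he =>
      rcases he with ((⟨a, rfl⟩ | ⟨a, rfl⟩) | h) | ⟨i, rfl⟩
      · exact hα a
      · exact hβ a
      · rw [Set.mem_singleton_iff.1 h]
        exact hδ
      · exact hp i
    | algebraMap r =>
      intro x hx
      rw [algebraMap_smul]
      exact N.smul_mem r hx
    | add e f _ _ he hf =>
      intro x hx
      rw [add_smul]
      exact N.add_mem (he x hx) (hf x hx)
    | mul e f _ _ he hf =>
      intro x hx
      rw [mul_smul]
      exact he _ (hf x hx)
  let N' : Submodule E X := { N.toAddSubmonoid with smul_mem' := fun e x hx => hE e x hx }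
  have hmem : ∀ x, x ∈ N' ↔ x ∈ N := fun _ => Iff.rfl
  rcases IsSimpleOrder.eq_bot_or_eq_top N' with h | h
  · left
    ext x
    rw [← hmem, h, Submodule.mem_bot, Submodule.mem_bot]
  · right
    ext x
    rw [← hmem, h]
    simp

variable [GradedAlgebra ℬ]

theorem α_proj_mul_p (ρ : PoissonRep ℬ PA E) (i j : ℤ) (a : A) :
    ρ.α (GradedAlgebra.proj ℬ i a) * ρ.p j = ρ.p (i + j) * (ρ.α a * ρ.p j) := by
  have h : LinearMap.mulRight k (ρ.p j) ∘ₗ ρ.α ∘ₗ GradedAlgebra.proj ℬ i =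
      LinearMap.mulLeft k (ρ.p (i + j)) ∘ₗ LinearMap.mulRight k (ρ.p j) ∘ₗ ρ.α := by
    refine linearMap_ext_of_homogeneous ℬ fun l c hc => ?_
    simp only [LinearMap.comp_apply, LinearMap.mulRight_apply, LinearMap.mulLeft_apply,
      proj_of_mem ℬ hc, ρ.α_p hc, ← mul_assoc, ρ.p_mul, add_left_inj]
    by_cases hl : l = i
    · simp [hl, ← ρ.α_p (hl ▸ hc)]
    · simp [hl, Ne.symm hl]
  exact LinearMap.congr_fun h a

theorem iSup_piece [IsSimpleModule E X] (ρ : PoissonRep ℬ PA E)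
    (hgen : Algebra.adjoin k ρ.gens = ⊤) {v : X} (hv : v ≠ 0) (hpv : ρ.p 0 • v = v) :
    ⨆ i, ρ.piece X i = ⊤ := by
  have key : ∀ e : E, (∀ j, ∃ i, e * ρ.p j = ρ.p i * e) → ∀ x ∈ ⨆ i, ρ.piece X i,
      e • x ∈ ⨆ i, ρ.piece X i := by
    intro e he
    have hle : ⨆ i, ρ.piece X i ≤ (⨆ i, ρ.piece X i).comap (Algebra.lsmul k k X e) := by
      refine iSup_le fun j x hx => ?_
      obtain ⟨i, hi⟩ := he j
      exact Submodule.mem_iSup_of_mem i (smul_mem_piece hi hx)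
    exact hle
  refine (ρ.eq_bot_or_eq_top hgen _ ?_ ?_ ?_ ?_).resolve_left ?_
  · intro a x hx
    exact forall_mem_of_homogeneous (ℬ := ℬ)
      ((LinearMap.toSpanSingleton E X x).restrictScalars k ∘ₗ ρ.α) _
      (fun i a ha => key _ (fun j => ⟨i + j, ρ.α_p ha j⟩) x hx) a
  · intro a x hx
    exact forall_mem_of_homogeneous (ℬ := ℬ)
      ((LinearMap.toSpanSingleton E X x).restrictScalars k ∘ₗ ρ.β) _
      (fun i a ha => key _ (fun j => ⟨i + j, ρ.β_p ha j⟩) x hx) a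
  · exact key _ fun j => ⟨j + 1, ρ.δ_p j⟩
  · intro i
    refine key _ fun j => ⟨j, ?_⟩
    rw [ρ.p_mul, ρ.p_mul]
    by_cases h : i = j
    · simp [h]
    · simp [h, Ne.symm h]
  · intro h
    have : v ∈ ⨆ i, ρ.piece X i := Submodule.mem_iSup_of_mem 0 (mem_piece.2 hpv)
    rw [h, Submodule.mem_bot] at this
    exact hv this

omit [GradedAlgebra ℬ] in
theorem iSupIndep_piece (ρ : PoissonRep ℬ PA E) : iSupIndep (ρ.piece X) := by
  rw [iSupIndep_def]
  intro i
  rw [Submodule.disjoint_def]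
  intro x hx hx'
  have hle : ⨆ j, ⨆ (_ : j ≠ i), ρ.piece X j ≤ LinearMap.ker (Algebra.lsmul k k X (ρ.p i)) := by
    refine iSup₂_le fun j hj y hy => ?_
    simpa [hj] using p_smul_of_mem hy i
  have h0 : ρ.p i • x = 0 := hle hx'
  rw [← mem_piece.1 hx, h0]

/-- The elements of `A` annihilating every element of `Z`. -/
def ann (ρ : PoissonRep ℬ PA E) (Z : Set X) : Submodule k A where
  carrier := {a | ∀ z ∈ Z, ρ.α a • z = 0}
  add_mem' ha hb z hz := by rw [map_add, add_smul, ha z hz, hb z hz, add_zero]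
  zero_mem' z _ := by rw [map_zero, zero_smul]
  smul_mem' r a ha z hz := by rw [map_smul, smul_assoc, ha z hz, smul_zero]

omit [IsScalarTower k E X] [Module k X] [GradedAlgebra ℬ] in
theorem d_smul_eq_zero (ρ : PoissonRep ℬ PA E) {i : ℤ} {a : A} (ha : a ∈ ℬ i) {z : X}
    (h : ρ.α a • z = 0) (h' : ρ.α a • ρ.δ • z = 0) : ρ.α (PA.d a) • z = 0 := by
  have := ρ.δ_α ha
  rw [← sub_eq_iff_eq_add] at this
  rw [← this, sub_smul, mul_smul, h, smul_zero, smul_assoc, mul_smul, h', smul_zero, sub_zero]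

theorem isDGIdeal_ann (ρ : PoissonRep ℬ PA E) {Z : Set X}
    (hZ : ∀ z ∈ Z, ∃ j, ρ.p j • z = z) (hδ : ∀ z ∈ Z, ρ.δ • z ∈ Z) :
    IsDGIdeal k ℬ PA.d (ρ.ann Z) := by
  have hgr : IsGradedSubmodule k ℬ (ρ.ann Z) := by
    rw [isGradedSubmodule_iff]
    intro i a ha z hz
    obtain ⟨j, hj⟩ := hZ z hz
    rw [← hj, smul_smul, α_proj_mul_p, mul_smul, mul_smul, hj, ha z hz, smul_zero]
  have hleft : ∀ r : A, ∀ m ∈ ρ.ann Z, r * m ∈ ρ.ann Z := by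
    intro r m hm z hz
    rw [ρ.α_mul, mul_smul, hm z hz, smul_zero]
  refine ⟨fun r m hm => ⟨hleft r m hm, ?_⟩, hgr, ?_⟩
  · refine hgr.induction (LinearMap.mulRight k r) (ρ.ann Z) (fun i a ha haZ => ?_) m hm
    refine forall_mem_of_homogeneous (ℬ := ℬ) (LinearMap.mulLeft k a) (ρ.ann Z)
      (fun j b hb => ?_) r
    rw [LinearMap.mulLeft_apply, PA.gcomm ha hb]
    exact zsmul_mem (hleft b a haZ) _
  · exact hgr.induction PA.d (ρ.ann Z) fun i a ha haZ z hz =>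
      ρ.d_smul_eq_zero ha (haZ z hz) (haZ _ (hδ z hz))

theorem isDGPoissonIdeal_ann_univ (ρ : PoissonRep ℬ PA E)
    (htop : ⨆ i, ρ.piece X i = ⊤) :
    IsDGPoissonIdeal k ℬ PA (ρ.ann (Set.univ : Set X)) := by
  have heq : ρ.ann {z : X | ∃ j, ρ.p j • z = z} = ρ.ann (Set.univ : Set X) := by
    refine le_antisymm (fun a ha z _ => ?_) fun a ha z _ => ha z trivial
    have hle : ⨆ i, ρ.piece X i ≤ LinearMap.ker (Algebra.lsmul k k X (ρ.α a)) :=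
      iSup_le fun j x (hx : x ∈ ρ.piece X j) => ha x ⟨j, mem_piece.1 hx⟩
    exact hle (htop ▸ Submodule.mem_top : z ∈ ⨆ i, ρ.piece X i)
  have hdg : IsDGIdeal k ℬ PA.d (ρ.ann (Set.univ : Set X)) := by
    rw [← heq]
    refine ρ.isDGIdeal_ann (fun z hz => hz) ?_
    rintro z ⟨j, hj⟩
    exact ⟨j + 1, mem_piece.1 (smul_mem_piece (ρ.δ_p j) (mem_piece.2 hj))⟩
  refine ⟨hdg, fun a m hm => ?_⟩
  refine hdg.2.1.induction (PA.br a) (ρ.ann (Set.univ : Set X)) (fun j b hb hbZ => ?_) m hm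
  refine forall_mem_of_homogeneous (ℬ := ℬ) (PA.br.flip b) (ρ.ann (Set.univ : Set X))
    (fun i c hc z _ => ?_) a
  have := ρ.β_α hc hb
  rw [← sub_eq_iff_eq_add] at this
  rw [LinearMap.flip_apply, ← this, sub_smul, mul_smul, hbZ z trivial, smul_zero, smul_assoc,
    mul_smul, hbZ _ trivial, smul_zero, sub_zero]

/-- A DG Poisson ideal annihilating a generator of a simple module annihilates the module. -/
theorem le_ann_univ [IsSimpleModule E X] (ρ : PoissonRep ℬ PA E)
    (hgen : Algebra.adjoin k ρ.gens = ⊤) {Q : Submodule k A} (hQ : IsDGPoissonIdeal k ℬ PA Q)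
    {v : X} (hv : v ≠ 0) (hQv : ∀ a ∈ Q, ρ.α a • v = 0) : Q ≤ ρ.ann (Set.univ : Set X) := by
  let Y : Submodule k X :=
    { carrier := {x | ∀ a ∈ Q, ρ.α a • x = 0}
      add_mem' := fun hx hy a ha => by rw [smul_add, hx a ha, hy a ha, add_zero]
      zero_mem' := fun a _ => smul_zero _
      smul_mem' := fun r x hx a ha => by
        rw [← algebraMap_smul E r x, smul_smul, ← Algebra.commutes, mul_smul, hx a ha,
          smul_zero] }
  have hY : ∀ x, (∀ i, ∀ a ∈ ℬ i, a ∈ Q → ρ.α a • x = 0) → x ∈ Y := fun x h =>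
    hQ.1.2.1.induction ((LinearMap.toSpanSingleton E X x).restrictScalars k ∘ₗ ρ.α) ⊥ h
  have htop : Y = ⊤ := by
    refine (ρ.eq_bot_or_eq_top hgen Y ?_ ?_ ?_ ?_).resolve_left fun h => hv ?_
    · intro b x hx a ha
      rw [smul_smul, ← ρ.α_mul]
      exact hx _ (hQ.1.1 b a ha).2
    · intro b x hx
      refine forall_mem_of_homogeneous (ℬ := ℬ)
        ((LinearMap.toSpanSingleton E X x).restrictScalars k ∘ₗ ρ.β) Y (fun j c hc => ?_) b
      refine hY _ fun i a ha haQ => ?_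
      change ρ.α a • ρ.β c • x = 0
      have h1 : ρ.β c • ρ.α a • x = (ρ.α (PA.br c a)) • x + sgn (j * i) • ρ.α a • ρ.β c • x := by
        rw [smul_smul, ρ.β_α hc ha, add_smul, smul_assoc, mul_smul]
      rw [hx a haQ, hx _ (hQ.2 c a haQ), smul_zero, zero_add] at h1
      rcases sgn_eq_one_or (j * i) with h | h <;> simpa [h] using h1.symm
    · intro x hx
      refine hY _ fun i a ha haQ => ?_
      have h1 : ρ.δ • ρ.α a • x = (ρ.α (PA.d a)) • x + sgn i • ρ.α a • ρ.δ • x := by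
        rw [smul_smul, ρ.δ_α ha, add_smul, smul_assoc, mul_smul]
      rw [hx a haQ, hx _ (hQ.1.2.2 a haQ), smul_zero, zero_add] at h1
      rcases sgn_eq_one_or i with h | h <;> simpa [h] using h1.symm
    · intro j x hx
      refine hY _ fun i a ha haQ => ?_
      rw [smul_smul, ρ.α_p ha, mul_smul, hx a haQ, smul_zero]
    · have : v ∈ Y := hQv
      rwa [h, Submodule.mem_bot] at this
  intro a ha x _
  exact (htop ▸ Submodule.mem_top : x ∈ Y) a ha

/-- If `M` is a maximal DG ideal killing the generator `v`, the annihilator of the whole module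
lies in `M`. -/
theorem ann_univ_le (ρ : PoissonRep ℬ PA E) {M : Submodule k A} (hM : IsDGIdeal k ℬ PA.d M)
    (hMmax : ∀ M' : Submodule k A, IsDGIdeal k ℬ PA.d M' → M ≤ M' → M' = M ∨ M' = ⊤)
    {v : X} (hv : v ≠ 0) (hpv : ρ.p 0 • v = v) (hMv : ∀ a ∈ M, ρ.α a • v = 0) :
    ρ.ann (Set.univ : Set X) ≤ M := by
  let Z : Set X := {z | z = v ∨ z = ρ.δ • v ∨ z = 0}
  have hZ : IsDGIdeal k ℬ PA.d (ρ.ann Z) := by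
    refine ρ.isDGIdeal_ann ?_ ?_
    · rintro z (rfl | rfl | rfl)
      · exact ⟨0, hpv⟩
      · exact ⟨0 + 1, mem_piece.1 (smul_mem_piece (ρ.δ_p 0) (mem_piece.2 hpv))⟩
      · exact ⟨0, smul_zero _⟩
    · rintro z (rfl | rfl | rfl)
      · exact Or.inr (Or.inl rfl)
      · right
        right
        rw [smul_smul, ρ.δ_sq, zero_smul]
      · exact Or.inr (Or.inr (smul_zero _))
  have hMZ : M ≤ ρ.ann Z := by
    refine fun m hm => hM.2.1.induction LinearMap.id (ρ.ann Z) (fun i a ha haM => ?_) m hm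
    rintro z (rfl | rfl | rfl)
    · exact hMv a haM
    · have h1 : ρ.δ • ρ.α a • v = (ρ.α (PA.d a)) • v + sgn i • ρ.α a • ρ.δ • v := by
        rw [smul_smul, ρ.δ_α ha, add_smul, smul_assoc, mul_smul]
      rw [hMv a haM, hMv _ (hM.2.2 a haM), smul_zero, zero_add] at h1
      rcases sgn_eq_one_or i with h | h <;> simpa [h] using h1.symm
    · exact smul_zero _
  rcases hMmax _ hZ hMZ with h | h
  · exact fun a ha => h ▸ fun z _ => ha z trivial
  · have h1 : (1 : A) ∈ ρ.ann Z := h ▸ Submodule.mem_top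
    have := h1 v (Or.inl rfl)
    rw [ρ.α_one, one_smul] at this
    exact absurd this hv

end Action

/-- The left ideal of operators sending everything into elements with degree `0` part in `M`. -/
def degreeZeroIdeal [GradedAlgebra ℬ] (E : Subalgebra k (Module.End k A)ᵐᵒᵖ)
    (M : Submodule k A) : Ideal E where
  carrier := {e | ∀ a, GradedAlgebra.proj ℬ 0 (e.1.unop a) ∈ M}
  add_mem' he hf a := by
    change GradedAlgebra.proj ℬ 0 (_ + _) ∈ M
    rw [map_add]
    exact M.add_mem (he a) (hf a)
  zero_mem' a := by
    change GradedAlgebra.proj ℬ 0 0 ∈ M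
    rw [map_zero]
    exact M.zero_mem
  smul_mem' e _ hf a := hf (e.1.unop a)

/-- A proper left ideal containing the relations of a degree-`0` vector killed by `M` yields a simple
module generated by such a vector. -/
theorem exists_quotient_of_ideal (ρ : PoissonRep ℬ PA E) {M : Submodule k A} {J : Ideal E}
    (hJ : J ≠ ⊤) (hp : ρ.p 0 - 1 ∈ J) (hM : ∀ a ∈ M, ρ.α a ∈ J) :
    ∃ (N : Submodule E E) (v : E ⧸ N), IsSimpleModule E (E ⧸ N) ∧ v ≠ 0 ∧ ρ.p 0 • v = v ∧
      ∀ a ∈ M, ρ.α a • v = 0 := by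
  obtain ⟨N, hN, hJN⟩ := Ideal.exists_le_maximal J hJ
  refine ⟨N, Submodule.Quotient.mk 1, isSimpleModule_iff_isCoatom.2 hN.out, ?_, ?_, ?_⟩
  · rw [Ne, Submodule.Quotient.mk_eq_zero, ← Ideal.eq_top_iff_one]
    exact hN.ne_top
  · rw [← Submodule.Quotient.mk_smul, Submodule.Quotient.eq, smul_eq_mul, mul_one]
    exact hJN hp
  · intro a ha
    rw [← Submodule.Quotient.mk_smul, Submodule.Quotient.mk_eq_zero, smul_eq_mul, mul_one]
    exact hJN (hM a ha)

/-- A proper DG ideal kills a nonzero degree-`0` vector of some simple representation. -/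
theorem exists_simple [GradedAlgebra ℬ] {M : Submodule k A} (hM : IsDGIdeal k ℬ PA.d M)
    (hMne : M ≠ ⊤) :
    ∃ (E : Type) (_ : Ring E) (_ : Algebra k E) (ρ : PoissonRep ℬ PA E) (N : Submodule E E)
      (v : E ⧸ N), Algebra.adjoin k ρ.gens = ⊤ ∧ IsSimpleModule E (E ⧸ N) ∧ v ≠ 0 ∧
        ρ.p 0 • v = v ∧ ∀ a ∈ M, ρ.α a • v = 0 := by
  have h1 : (1 : A) ∉ M := fun h => hMne <| eq_top_iff.2 fun a _ => by
    simpa using (hM.1 a 1 h).1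
  have hgr := isGradedSubmodule_iff.1 hM.2.1
  let J := degreeZeroIdeal (ℬ := ℬ) (Algebra.adjoin k (regular PA).gens) M
  have hJ : J ≠ ⊤ := fun h => h1 <| by
    have : (1 : Algebra.adjoin k (regular PA).gens) ∈ J := h ▸ Submodule.mem_top
    have := this 1
    change GradedAlgebra.proj ℬ 0 1 ∈ M at this
    rwa [proj_of_mem ℬ SetLike.GradedOne.one_mem, if_pos rfl] at this
  have hp : (regular PA).restrict.p 0 - 1 ∈ J := fun a => by
    change GradedAlgebra.proj ℬ 0 (GradedAlgebra.proj ℬ (-0) a - a) ∈ M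
    rw [neg_zero, map_sub, proj_of_mem ℬ (proj_mem ℬ 0 a), if_pos rfl, sub_self]
    exact M.zero_mem
  obtain ⟨N, v, h⟩ := (regular PA).restrict.exists_quotient_of_ideal (M := M) hJ hp
    fun a ha b => hgr 0 _ (hM.1 b a ha).1
  exact ⟨_, _, _, _, N, v, adjoin_gens_restrict _, h⟩

end PoissonRep

/-- Assume `char k = 2` or every `|x_i|` is even, so that the
monomials form a `k`-basis of `R`.  Let `A = R/I` be a DG Poisson homomorphic image of
`R`.  If `P` is a DG symplectic ideal of `A` (witnessed by a maximal DG ideal `M` of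
`A` such that `P` is the largest DG Poisson ideal contained in `M`), then `P` is the
annihilator of a simple DG Poisson `A`-module. -/
theorem stmt19 (k R A : Type) [Field k] [Ring R] [Algebra k R] [Ring A] [Algebra k A]
    (n : ℕ) (𝒜 : ℤ → Submodule k R) [GradedAlgebra 𝒜]
    (ℬ : ℤ → Submodule k A) [GradedAlgebra ℬ]
    (P : DGPoissonAlgebra k R 𝒜)
    (x : Fin n → R) (w : Fin n → ℤ) (hx : ∀ i, x i ∈ 𝒜 (w i))
    (hgen : Algebra.adjoin k (Set.range x) = ⊤)
    (hchar : ringChar k = 2 ∨ ∀ i, Even (w i))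
    (hbasis : LinearIndependent k (fun e : Fin n → ℕ => xMono x e) ∧
      Submodule.span k (Set.range fun e : Fin n → ℕ => xMono x e) = ⊤)
    -- the DG Poisson ideal `I` and the quotient `A = R/I`
    (I : Submodule k R) (hI : IsDGPoissonIdeal k 𝒜 P I)
    (π' : R →ₐ[k] A) (hπ' : IsQuotientBy k π' I)
    (hπ'mem : ∀ ⦃i : ℤ⦄ ⦃a : R⦄, a ∈ 𝒜 i → π' a ∈ ℬ i)
    (PA : DGPoissonAlgebra k A ℬ)
    (hPAd : ∀ r : R, PA.d (π' r) = π' (P.d r))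
    (hPAbr : ∀ r s : R, PA.br (π' r) (π' s) = π' (P.br r s))
    -- `Pid` is a DG symplectic ideal of `A`, witnessed by the maximal DG ideal `M`
    (Pid M : Submodule k A)
    (hM : IsDGIdeal k ℬ PA.d M) (hMne : M ≠ ⊤)
    (hMmax : ∀ M' : Submodule k A, IsDGIdeal k ℬ PA.d M' → M ≤ M' → M' = M ∨ M' = ⊤)
    (hP : IsDGPoissonIdeal k ℬ PA Pid) (hPM : Pid ≤ M)
    (hPmax : ∀ P' : Submodule k A, IsDGPoissonIdeal k ℬ PA P' → P' ≤ M → P' ≤ Pid) :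
    -- there is a simple DG Poisson `A`-module `X` with `ann_A(X) = Pid`
    ∃ (X : ModuleCat.{0} k) (𝒳 : ℤ → Submodule k X)
      (_ : DirectSum.Decomposition 𝒳)
      (act : A →ₗ[k] X →ₗ[k] X) (bdry : X →ₗ[k] X) (brX : A →ₗ[k] X →ₗ[k] X),
      -- `X` is a graded left `A`-module
      (∀ xx : X, act 1 xx = xx) ∧
      (∀ a b : A, ∀ xx : X, act (a * b) xx = act a (act b xx)) ∧
      (∀ ⦃i j : ℤ⦄ ⦃a : A⦄ ⦃xx : X⦄, a ∈ ℬ i → xx ∈ 𝒳 j → act a xx ∈ 𝒳 (i + j)) ∧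
      -- `(X, ∂)` is a DG module over the DG algebra `A`
      (∀ ⦃i : ℤ⦄ ⦃xx : X⦄, xx ∈ 𝒳 i → bdry xx ∈ 𝒳 (i + 1)) ∧
      (∀ xx : X, bdry (bdry xx) = 0) ∧
      (∀ ⦃i : ℤ⦄ ⦃a : A⦄, a ∈ ℬ i → ∀ xx : X,
        bdry (act a xx) = act (PA.d a) xx + sgn i • act a (bdry xx)) ∧
      -- `X` is a graded Poisson module
      (∀ ⦃i j : ℤ⦄ ⦃a : A⦄ ⦃xx : X⦄, a ∈ ℬ i → xx ∈ 𝒳 j → brX a xx ∈ 𝒳 (i + j)) ∧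
      (∀ ⦃i j : ℤ⦄ ⦃a b : A⦄, a ∈ ℬ i → b ∈ ℬ j → ∀ xx : X,
        brX a (act b xx) = act (PA.br a b) xx + sgn (i * j) • act b (brX a xx)) ∧
      (∀ ⦃i j : ℤ⦄ ⦃a b : A⦄, a ∈ ℬ i → b ∈ ℬ j → ∀ xx : X,
        brX (a * b) xx = act a (brX b xx) + sgn (i * j) • act b (brX a xx)) ∧
      (∀ ⦃i j : ℤ⦄ ⦃a b : A⦄, a ∈ ℬ i → b ∈ ℬ j → ∀ xx : X,
        brX a (brX b xx) = brX (PA.br a b) xx + sgn (i * j) • brX b (brX a xx)) ∧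
      -- the differential is compatible with the bracket
      (∀ ⦃i : ℤ⦄ ⦃a : A⦄, a ∈ ℬ i → ∀ xx : X,
        bdry (brX a xx) = brX (PA.d a) xx + sgn i • brX a (bdry xx)) ∧
      -- `X` is simple: nonzero, with no nonzero proper DG Poisson submodule
      Nontrivial X ∧
      (∀ N : Submodule k X, (∀ a : A, ∀ xx ∈ N, act a xx ∈ N) →
        IsGradedSubmodule k 𝒳 N → (∀ xx ∈ N, bdry xx ∈ N) →
        (∀ a : A, ∀ xx ∈ N, brX a xx ∈ N) → N = ⊥ ∨ N = ⊤) ∧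
      -- `ann_A(X) = Pid`
      (∀ a : A, (∀ xx : X, act a xx = 0) ↔ a ∈ Pid) := by
  obtain ⟨E, _, _, ρ, J, v, hgen, hsimple, hv, hpv, hMv⟩ := PoissonRep.exists_simple hM hMne
  have htop := ρ.iSup_piece hgen hv hpv
  have hann : ρ.ann (Set.univ : Set (E ⧸ J)) = Pid :=
    le_antisymm
      (hPmax _ (ρ.isDGPoissonIdeal_ann_univ htop) (ρ.ann_univ_le hM hMmax hv hpv hMv))
      (ρ.le_ann_univ hgen hP hv fun a ha => hMv a (hPM ha))
  refine ⟨ModuleCat.of k (E ⧸ J), ρ.piece (E ⧸ J),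
    (DirectSum.isInternal_submodule_of_iSupIndep_of_iSup_eq_top
      ρ.iSupIndep_piece htop).chooseDecomposition,
    (Algebra.lsmul k k (E ⧸ J)).toLinearMap ∘ₗ ρ.α, Algebra.lsmul k k (E ⧸ J) ρ.δ,
    (Algebra.lsmul k k (E ⧸ J)).toLinearMap ∘ₗ ρ.β, ?_⟩
  have key : ∀ {e₁ e₂ f g₁ g₂ : E} {s : ℤ}, e₁ * e₂ = f + s • (g₁ * g₂) →
      ∀ xx : E ⧸ J, e₁ • e₂ • xx = f • xx + s • g₁ • g₂ • xx := by
    intro e₁ e₂ f g₁ g₂ s h xx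
    rw [smul_smul, h, add_smul, smul_assoc, mul_smul]
  refine ⟨fun xx => ?_, fun a b xx => ?_, fun i j a xx ha hxx => ?_, fun i xx hxx => ?_,
    fun xx => ?_, fun i a ha => key (ρ.δ_α ha), fun i j a xx ha hxx => ?_,
    fun i j a b ha hb => key (ρ.β_α ha hb), fun i j a b ha hb xx => ?_,
    fun i j a b ha hb => key (ρ.β_β ha hb), fun i a ha => key (ρ.δ_β ha), ⟨v, 0, hv⟩,
    fun N hNα hNgr hNδ hNβ => ?_, fun a => ?_⟩
  · change ρ.α 1 • xx = xx
    rw [ρ.α_one, one_smul]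
  · change ρ.α (a * b) • xx = ρ.α a • ρ.α b • xx
    rw [ρ.α_mul, mul_smul]
  · exact PoissonRep.smul_mem_piece (ρ.α_p ha j) hxx
  · exact PoissonRep.smul_mem_piece (ρ.δ_p i) hxx
  · change ρ.δ • ρ.δ • xx = 0
    rw [smul_smul, ρ.δ_sq, zero_smul]
  · exact PoissonRep.smul_mem_piece (ρ.β_p ha j) hxx
  · change ρ.β (a * b) • xx = ρ.α a • ρ.β b • xx + sgn (i * j) • ρ.α b • ρ.β a • xx
    rw [ρ.β_mul ha hb, add_smul, smul_assoc, mul_smul, mul_smul]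
  · refine ρ.eq_bot_or_eq_top hgen N hNα hNβ hNδ fun i xx hxx => ?_
    have hle : Submodule.span k {y : E ⧸ J | y ∈ N ∧ ∃ j, y ∈ ρ.piece (E ⧸ J) j} ≤
        N.comap (Algebra.lsmul k k (E ⧸ J) (ρ.p i)) := by
      refine Submodule.span_le.2 ?_
      rintro y ⟨hy, j, hj⟩
      change ρ.p i • y ∈ N
      rw [PoissonRep.p_smul_of_mem hj]
      split_ifs
      exacts [hy, N.zero_mem]
    exact hle (hNgr hxx)
  · rw [← hann]
    exact ⟨fun h z _ => h z, fun h z => h z trivial⟩
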